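/- arXiv:2401.10356 — 4 statements merged into one kernel-verified Lean document; each statement's English description precedes it below -/
import Mathlib

section
/- Verification theorem for the tracer mean field game (MFG-1) in one space dimension: Let D ≥ 0, P > 0 and t < T be real numbers. Let u, F : [t,T] × ℝ → ℝ be continuous and P-periodic in the space variable, and let G, ρ : ℝ → ℝ be continuous and P-periodic with ρ ≥ 0. Suppose φ : [t,T] × ℝ → ℝ is C¹ in time and C² in space with continuous derivatives, P-periodic in space, and solves the backward Hamilton–Jacobi equation ∂_sφ + (1/2)(∂_xφ)² + u ∂_xφ + D ∂_x²φ = F on [t,T] × ℝ with terminal condition φ(T,·) = −G. Let ρ̂ : [t,T] × ℝ → ℝ be C¹ in time and C² in space with continuous derivatives, nonnegative and P-periodic in space, and let α̂ : [t,T] × ℝ → ℝ be continuous, C¹ in space and P-periodic in space, such that ∂_sρ̂ + ∂_x((u + α̂)ρ̂) = D ∂_x²ρ̂ on [t,T] × ℝ and ρ̂(t,·) = ρ. Then ∫₀^P G(x) ρ̂(T,x) dx + ∫_t^T ∫₀^P ((1/2) α̂(s,x)² + F(s,x)) ρ̂(s,x) dx ds ≥ −∫₀^P ρ(x) φ(t,x)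 dx, and equality holds if α̂(s,x) = ∂_xφ(s,x) for all (s,x) ∈ [t,T] × ℝ. -/
open Set MeasureTheory intervalIntegral

/-- A function on a rectangle that is continuous in the first variable and has a jointly continuous
derivative in the second variable is jointly continuous. -/
lemma continuousOn_rectangle_of_hasDerivAt_right {f f' : ℝ → ℝ → ℝ} {a b c d : ℝ}
    (hf : ∀ x ∈ Icc c d, ContinuousOn (fun s => f s x) (Icc a b))
    (hf' : ∀ s ∈ Icc a b, ∀ x ∈ Icc c d, HasDerivAt (fun y => f s y) (f' s x) x)
    (hcont : ContinuousOn (fun p : ℝ × ℝ => f' p.1 p.2) (Icc a b ×ˢ Icc c d)) :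
    ContinuousOn (fun p : ℝ × ℝ => f p.1 p.2) (Icc a b ×ˢ Icc c d) := by
  obtain ⟨C, hC⟩ := (isCompact_Icc.prod isCompact_Icc).exists_bound_of_continuousOn hcont
  refine continuousOn_prod_of_continuousOn_lipschitzOnWith' _ C.toNNReal (fun s hs => ?_) hf
  refine (convex_Icc c d).lipschitzOnWith_of_nnnorm_hasDerivWithin_le (f' := f' s)
    (fun x hx => (hf' s hs x hx).hasDerivWithinAt) (fun x hx => ?_)
  exact NNReal.le_toNNReal_of_coe_le (hC (s, x) ⟨hs, hx⟩)

lemma integrable_prod_restrict_of_continuousOn_rectangle {f : ℝ → ℝ → ℝ} {a b c d : ℝ}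
    (hf : ContinuousOn (fun p : ℝ × ℝ => f p.1 p.2) (Icc a b ×ˢ Icc c d)) :
    Integrable (fun p : ℝ × ℝ => f p.1 p.2)
      ((volume.restrict (Ioc a b)).prod (volume.restrict (Ioc c d))) := by
  rw [Measure.prod_restrict, ← Measure.volume_eq_prod]
  exact (hf.integrableOn_compact (isCompact_Icc.prod isCompact_Icc)).mono_set
    (prod_mono Ioc_subset_Icc_self Ioc_subset_Icc_self)

lemma intervalIntegral_swap_of_continuousOn_rectangle {f : ℝ → ℝ → ℝ} {a b c d : ℝ}
    (hab : a ≤ b) (hcd : c ≤ d)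
    (hf : ContinuousOn (fun p : ℝ × ℝ => f p.1 p.2) (Icc a b ×ˢ Icc c d)) :
    ∫ s in a..b, ∫ x in c..d, f s x = ∫ x in c..d, ∫ s in a..b, f s x := by
  simp only [integral_of_le hab, integral_of_le hcd]
  exact integral_integral_swap (integrable_prod_restrict_of_continuousOn_rectangle hf)

lemma intervalIntegrable_integral_of_continuousOn_rectangle {f : ℝ → ℝ → ℝ} {a b c d : ℝ}
    (hab : a ≤ b) (hcd : c ≤ d)
    (hf : ContinuousOn (fun p : ℝ × ℝ => f p.1 p.2) (Icc a b ×ˢ Icc c d)) :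
    IntervalIntegrable (fun s => ∫ x in c..d, f s x) volume a b := by
  simp only [intervalIntegrable_iff_integrableOn_Ioc_of_le hab, integral_of_le hcd]
  exact (integrable_prod_restrict_of_continuousOn_rectangle hf).integral_prod_left

lemma intervalIntegrable_slice_of_continuousOn_rectangle {f : ℝ → ℝ → ℝ} {a b c d s : ℝ}
    (hcd : c ≤ d) (hs : s ∈ Icc a b)
    (hf : ContinuousOn (fun p : ℝ × ℝ => f p.1 p.2) (Icc a b ×ˢ Icc c d)) :
    IntervalIntegrable (fun x => f s x) volume c d :=
  ContinuousOn.intervalIntegrable_of_Icc hcd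
    (hf.comp (f := fun x : ℝ => (s, x)) (by fun_prop) fun _ hx => ⟨hs, hx⟩)

/-- The integral over space of a jointly continuous time derivative, integrated over time, is the
increment of the integral over space. -/
lemma integral_integral_eq_sub_of_hasDerivWithinAt_left {f f' : ℝ → ℝ → ℝ} {a b c d : ℝ}
    (hab : a ≤ b) (hcd : c ≤ d)
    (hderiv : ∀ s ∈ Icc a b, ∀ x, HasDerivWithinAt (fun τ => f τ x) (f' s x) (Icc a b) s)
    (hf : ContinuousOn (fun p : ℝ × ℝ => f p.1 p.2) (Icc a b ×ˢ Icc c d))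
    (hf' : ContinuousOn (fun p : ℝ × ℝ => f' p.1 p.2) (Icc a b ×ˢ Icc c d)) :
    ∫ s in a..b, ∫ x in c..d, f' s x = (∫ x in c..d, f b x) - ∫ x in c..d, f a x := by
  rw [intervalIntegral_swap_of_continuousOn_rectangle hab hcd hf', ← integral_sub
    (intervalIntegrable_slice_of_continuousOn_rectangle hcd (right_mem_Icc.2 hab) hf)
    (intervalIntegrable_slice_of_continuousOn_rectangle hcd (left_mem_Icc.2 hab) hf)]
  refine integral_congr fun x hx => ?_
  rw [uIcc_of_le hcd] at hx
  refine integral_eq_sub_of_hasDerivAt_of_le hab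
    (fun s hs => (hderiv s hs x).continuousWithinAt)
    (fun s hs => (hderiv s (Ioo_subset_Icc_self hs) x).hasDerivAt (Icc_mem_nhds hs.1 hs.2)) ?_
  exact ContinuousOn.intervalIntegrable_of_Icc hab
    (hf'.comp (f := fun s : ℝ => (s, x)) (by fun_prop) fun _ hs => ⟨hs, hx⟩)

lemma hasDerivAt_periodic {f f' : ℝ → ℝ} {P : ℝ} (hf : ∀ x, HasDerivAt f (f' x) x)
    (hper : ∀ x, f (x + P) = f x) (x : ℝ) : f' (x + P) = f' x :=
  (((hf (x + P)).comp_add_const x P).congr_of_eventuallyEq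
    (.of_forall fun y => (hper y).symm)).unique (hf x)

/-- Verification theorem for the tracer mean field game (MFG-1) in one space
dimension, on a spatial period `[0, P]`.  The adjoint `φ` solves the backward
Hamilton–Jacobi equation with terminal datum `-G`, and any admissible pair
`(ρ̂, α̂)` solving the forward continuity equation from initial datum `ρ` has total
cost at least `-∫₀ᴾ ρ φ(t,·)`, with equality when `α̂ = ∂ₓφ`. -/
theorem mfg1_verification
    (D P t T : ℝ) (hD : 0 ≤ D) (hP : 0 < P) (htT : t < T)
    (u F : ℝ → ℝ → ℝ) (G ρ : ℝ → ℝ)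
    (hu_cont : ContinuousOn (fun p : ℝ × ℝ => u p.1 p.2) (Icc t T ×ˢ univ))
    (hF_cont : ContinuousOn (fun p : ℝ × ℝ => F p.1 p.2) (Icc t T ×ˢ univ))
    (hu_per : ∀ s x, u s (x + P) = u s x)
    (hF_per : ∀ s x, F s (x + P) = F s x)
    (hG_cont : Continuous G) (hG_per : ∀ x, G (x + P) = G x)
    (hρ_cont : Continuous ρ) (hρ_per : ∀ x, ρ (x + P) = ρ x)
    (hρ_nonneg : ∀ x, 0 ≤ ρ x)
    -- the adjoint function φ, C¹ in time and C² in space, periodic in space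
    (φ φs φx φxx : ℝ → ℝ → ℝ)
    (hφs : ∀ s ∈ Icc t T, ∀ x : ℝ,
      HasDerivWithinAt (fun τ => φ τ x) (φs s x) (Icc t T) s)
    (hφx : ∀ s ∈ Icc t T, ∀ x : ℝ, HasDerivAt (fun y => φ s y) (φx s x) x)
    (hφxx : ∀ s ∈ Icc t T, ∀ x : ℝ, HasDerivAt (fun y => φx s y) (φxx s x) x)
    (hφs_cont : ContinuousOn (fun p : ℝ × ℝ => φs p.1 p.2) (Icc t T ×ˢ univ))
    (hφx_cont : ContinuousOn (fun p : ℝ × ℝ => φx p.1 p.2) (Icc t T ×ˢ univ))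
    (hφxx_cont : ContinuousOn (fun p : ℝ × ℝ => φxx p.1 p.2) (Icc t T ×ˢ univ))
    (hφ_per : ∀ s x, φ s (x + P) = φ s x)
    -- backward Hamilton–Jacobi equation with terminal condition φ(T,·) = -G
    (hφ_hje : ∀ s ∈ Icc t T, ∀ x : ℝ,
      φs s x + (1 / 2) * (φx s x) ^ 2 + u s x * φx s x + D * φxx s x = F s x)
    (hφ_term : ∀ x, φ T x = -G x)
    -- the controlled density ρ̂, C¹ in time and C² in space, nonnegative, periodic
    (ρh ρhs ρhx ρhxx : ℝ → ℝ → ℝ)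
    (hρhs : ∀ s ∈ Icc t T, ∀ x : ℝ,
      HasDerivWithinAt (fun τ => ρh τ x) (ρhs s x) (Icc t T) s)
    (hρhx : ∀ s ∈ Icc t T, ∀ x : ℝ, HasDerivAt (fun y => ρh s y) (ρhx s x) x)
    (hρhxx : ∀ s ∈ Icc t T, ∀ x : ℝ, HasDerivAt (fun y => ρhx s y) (ρhxx s x) x)
    (hρhs_cont : ContinuousOn (fun p : ℝ × ℝ => ρhs p.1 p.2) (Icc t T ×ˢ univ))
    (hρhx_cont : ContinuousOn (fun p : ℝ × ℝ => ρhx p.1 p.2) (Icc t T ×ˢ univ))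
    (hρhxx_cont : ContinuousOn (fun p : ℝ × ℝ => ρhxx p.1 p.2) (Icc t T ×ˢ univ))
    (hρh_nonneg : ∀ s ∈ Icc t T, ∀ x : ℝ, 0 ≤ ρh s x)
    (hρh_per : ∀ s x, ρh s (x + P) = ρh s x)
    -- the control α̂, continuous, C¹ in space, periodic in space
    (α αx : ℝ → ℝ → ℝ)
    (hα_cont : ContinuousOn (fun p : ℝ × ℝ => α p.1 p.2) (Icc t T ×ˢ univ))
    (hαx : ∀ s ∈ Icc t T, ∀ x : ℝ, HasDerivAt (fun y => α s y) (αx s x) x)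
    (hα_per : ∀ s x, α s (x + P) = α s x)
    -- forward continuity equation ∂ₛρ̂ + ∂ₓ((u + α̂)ρ̂) = D ∂ₓ²ρ̂, initial datum ρ
    (hρh_pde : ∀ s ∈ Icc t T, ∀ x : ℝ,
      HasDerivAt (fun y => (u s y + α s y) * ρh s y)
        (D * ρhxx s x - ρhs s x) x)
    (hρh_init : ∀ x, ρh t x = ρ x) :
    (∫ x in (0:ℝ)..P, G x * ρh T x) +
        (∫ s in t..T, ∫ x in (0:ℝ)..P,
          ((1 / 2) * (α s x) ^ 2 + F s x) * ρh s x) ≥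
      -(∫ x in (0:ℝ)..P, ρ x * φ t x) ∧
    ((∀ s ∈ Icc t T, ∀ x : ℝ, α s x = φx s x) →
      (∫ x in (0:ℝ)..P, G x * ρh T x) +
          (∫ s in t..T, ∫ x in (0:ℝ)..P,
            ((1 / 2) * (α s x) ^ 2 + F s x) * ρh s x) =
        -(∫ x in (0:ℝ)..P, ρ x * φ t x)) := by
  have hsub : Icc t T ×ˢ Icc 0 P ⊆ Icc t T ×ˢ (univ : Set ℝ) := prod_mono le_rfl (subset_univ _)
  replace hF_cont := hF_cont.mono hsub
  replace hφs_cont := hφs_cont.mono hsub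
  replace hφx_cont := hφx_cont.mono hsub
  replace hρhs_cont := hρhs_cont.mono hsub
  replace hρhx_cont := hρhx_cont.mono hsub
  replace hα_cont := hα_cont.mono hsub
  have hφ_cont : ContinuousOn (fun p : ℝ × ℝ => φ p.1 p.2) (Icc t T ×ˢ Icc 0 P) :=
    continuousOn_rectangle_of_hasDerivAt_right
      (fun x _ s hs => (hφs s hs x).continuousWithinAt) (fun s hs x _ => hφx s hs x) hφx_cont
  have hρh_cont : ContinuousOn (fun p : ℝ × ℝ => ρh p.1 p.2) (Icc t T ×ˢ Icc 0 P) :=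
    continuousOn_rectangle_of_hasDerivAt_right
      (fun x _ s hs => (hρhs s hs x).continuousWithinAt) (fun s hs x _ => hρhx s hs x) hρhx_cont
  have hpair_cont : ContinuousOn (fun p : ℝ × ℝ => φs p.1 p.2 * ρh p.1 p.2
      + φ p.1 p.2 * ρhs p.1 p.2) (Icc t T ×ˢ Icc 0 P) := by fun_prop
  have hcost_cont : ContinuousOn (fun p : ℝ × ℝ =>
      ((1 / 2) * (α p.1 p.2) ^ 2 + F p.1 p.2) * ρh p.1 p.2) (Icc t T ×ˢ Icc 0 P) := by fun_prop
  have hgap_cont : ContinuousOn (fun p : ℝ × ℝ =>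
      (1 / 2) * (α p.1 p.2 - φx p.1 p.2) ^ 2 * ρh p.1 p.2) (Icc t T ×ˢ Icc 0 P) := by fun_prop
  have htime : ∫ s in t..T, ∫ x in (0:ℝ)..P, (φs s x * ρh s x + φ s x * ρhs s x)
      = (∫ x in (0:ℝ)..P, φ T x * ρh T x) - ∫ x in (0:ℝ)..P, φ t x * ρh t x :=
    integral_integral_eq_sub_of_hasDerivWithinAt_left (f := fun s x => φ s x * ρh s x) htT.le hP.le
      (fun s hs x => (hφs s hs x).mul (hρhs s hs x)) (hφ_cont.mul hρh_cont) hpair_cont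
  have hspace : ∀ s ∈ Icc t T, ∫ x in (0:ℝ)..P, (φs s x * ρh s x + φ s x * ρhs s x)
      = (∫ x in (0:ℝ)..P, ((1 / 2) * (α s x) ^ 2 + F s x) * ρh s x)
        - ∫ x in (0:ℝ)..P, (1 / 2) * (α s x - φx s x) ^ 2 * ρh s x := by
    intro s hs
    have hpair := intervalIntegrable_slice_of_continuousOn_rectangle
      (f := fun s x => φs s x * ρh s x + φ s x * ρhs s x) hP.le hs hpair_cont
    have hcost := intervalIntegrable_slice_of_continuousOn_rectangle
      (f := fun s x => ((1 / 2) * (α s x) ^ 2 + F s x) * ρh s x) hP.le hs hcost_cont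
    have hgap := intervalIntegrable_slice_of_continuousOn_rectangle
      (f := fun s x => (1 / 2) * (α s x - φx s x) ^ 2 * ρh s x) hP.le hs hgap_cont
    -- the difference of the integrands is the derivative of a periodic flux
    have hflux : ∀ x, HasDerivAt (fun y => D * (φ s y * ρhx s y - φx s y * ρh s y)
        - φ s y * ((u s y + α s y) * ρh s y))
        ((φs s x * ρh s x + φ s x * ρhs s x) - (((1 / 2) * (α s x) ^ 2 + F s x) * ρh s x
          - (1 / 2) * (α s x - φx s x) ^ 2 * ρh s x)) x := by
      intro x
      have h := ((((hφx s hs x).mul (hρhxx s hs x)).sub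
        ((hφxx s hs x).mul (hρhx s hs x))).const_mul D).sub
        ((hφx s hs x).mul (hρh_pde s hs x))
      refine h.congr_deriv ?_
      linear_combination (-ρh s x) * hφ_hje s hs x
    have hzero := integral_eq_sub_of_hasDerivAt (a := 0) (b := P) (fun x _ => hflux x)
      (hpair.sub (hcost.sub hgap))
    have hφx_per := hasDerivAt_periodic (hφx s hs) (hφ_per s) 0
    have hρhx_per := hasDerivAt_periodic (hρhx s hs) (hρh_per s) 0
    have hφ0 := hφ_per s 0
    have hρh0 := hρh_per s 0
    have hu0 := hu_per s 0
    have hα0 := hα_per s 0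
    rw [zero_add] at hφx_per hρhx_per hφ0 hρh0 hu0 hα0
    rw [hφx_per, hρhx_per, hφ0, hρh0, hu0, hα0, sub_self,
      integral_sub hpair (hcost.sub hgap), integral_sub hcost hgap] at hzero
    exact sub_eq_zero.1 hzero
  have hbalance : (∫ x in (0:ℝ)..P, G x * ρh T x) + (∫ s in t..T, ∫ x in (0:ℝ)..P,
        ((1 / 2) * (α s x) ^ 2 + F s x) * ρh s x) = -(∫ x in (0:ℝ)..P, ρ x * φ t x)
      + ∫ s in t..T, ∫ x in (0:ℝ)..P, (1 / 2) * (α s x - φx s x) ^ 2 * ρh s x := by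
    rw [integral_congr fun s hs => hspace s (by rwa [uIcc_of_le htT.le] at hs),
      integral_sub
        (intervalIntegrable_integral_of_continuousOn_rectangle htT.le hP.le hcost_cont)
        (intervalIntegrable_integral_of_continuousOn_rectangle
          (f := fun s x => (1 / 2) * (α s x - φx s x) ^ 2 * ρh s x) htT.le hP.le hgap_cont)]
      at htime
    simp only [hφ_term, hρh_init, neg_mul, intervalIntegral.integral_neg] at htime
    simp only [mul_comm (ρ _)]
    linarith
  rw [hbalance]
  refine ⟨?_, fun hopt => ?_⟩
  · refine le_add_of_nonneg_right (integral_nonneg htT.le fun s hs =>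
      integral_nonneg hP.le fun x _ => ?_)
    have := hρh_nonneg s hs x
    positivity
  · rw [add_eq_left]
    refine (integral_congr (g := fun _ => 0) fun s hs => ?_).trans (by simp)
    rw [uIcc_of_le htT.le] at hs
    simp [hopt s hs]
end

section
/- Value function identity for the tracer mean field game in one space dimension: Let D ≥ 0, P > 0 and t < T. Let u, F : [t,T] × ℝ → ℝ be continuous and P-periodic in space, and G : ℝ → ℝ continuous and P-periodic. Suppose φ, ρ : [t,T] × ℝ → ℝ are C¹ in time and C² in space with continuous derivatives and P-periodic in space, φ solves the backward Hamilton–Jacobi equation ∂_sφ + (1/2)(∂_xφ)² + u ∂_xφ + D ∂_x²φ = F on [t,T] × ℝ with φ(T,·) = −G, and ρ solves the forward Fokker–Planck equation ∂_sρ + ∂_x((u + ∂_xφ)ρ) = D ∂_x²ρ on [t,T] × ℝ. Then ∫₀^P G(x) ρ(T,x) dx + ∫_t^T ∫₀^P ((1/2)(∂_xφ(s,x))² + F(s,x)) ρ(s,x) dx ds = −∫₀^P ρ(t,x) φ(t,x) dx. -/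
open Set MeasureTheory intervalIntegral

/-- A function of `(s, x)` that is differentiable in `s` with jointly continuous derivative and
continuous in `x` is jointly continuous on a compact rectangle. -/
theorem continuousOn_rectangle_of_hasDerivWithinAt {a b c d : ℝ} {f f' : ℝ → ℝ → ℝ}
    (hf' : ∀ s ∈ Icc a b, ∀ x ∈ Icc c d,
      HasDerivWithinAt (fun τ => f τ x) (f' s x) (Icc a b) s)
    (hf'_cont : ContinuousOn (fun p : ℝ × ℝ => f' p.1 p.2) (Icc a b ×ˢ Icc c d))
    (hf_cont : ∀ s ∈ Icc a b, ContinuousOn (f s) (Icc c d)) :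
    ContinuousOn (fun p : ℝ × ℝ => f p.1 p.2) (Icc a b ×ˢ Icc c d) := by
  obtain ⟨C, hC⟩ := (isCompact_Icc.prod isCompact_Icc).exists_bound_of_continuousOn hf'_cont
  refine continuousOn_prod_of_continuousOn_lipschitzOnWith _ C.toNNReal hf_cont fun x hx => ?_
  refine (convex_Icc a b).lipschitzOnWith_of_nnnorm_hasDerivWithin_le
    (fun s hs => hf' s hs x hx) fun s hs => ?_
  rw [← NNReal.coe_le_coe, coe_nnnorm]
  exact (hC (s, x) ⟨hs, hx⟩).trans (Real.le_coe_toNNReal C)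

/-- The increment of `∫ f` over a time interval is the iterated integral of the time derivative. -/
theorem integral_sub_integral_eq_integral_integral_deriv {a b c d : ℝ} (hab : a ≤ b) (hcd : c ≤ d)
    {f f' : ℝ → ℝ → ℝ}
    (hf' : ∀ s ∈ Icc a b, ∀ x ∈ Icc c d,
      HasDerivWithinAt (fun τ => f τ x) (f' s x) (Icc a b) s)
    (hf'_cont : ContinuousOn (fun p : ℝ × ℝ => f' p.1 p.2) (Icc a b ×ˢ Icc c d))
    (hf_cont : ∀ s ∈ Icc a b, ContinuousOn (f s) (Icc c d)) :
    (∫ x in c..d, f b x) - (∫ x in c..d, f a x) = ∫ s in a..b, ∫ x in c..d, f' s x := by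
  have hint : ∀ s ∈ Icc a b, IntervalIntegrable (f s) volume c d := fun s hs =>
    (hf_cont s hs).intervalIntegrable_of_Icc hcd
  have hFTC : ∀ x ∈ Icc c d, ∫ s in a..b, f' s x = f b x - f a x := fun x hx =>
    integral_eq_sub_of_hasDerivAt_of_le hab
      (fun s hs => (hf' s hs x hx).continuousWithinAt)
      (fun s hs => (hf' s (Ioo_subset_Icc_self hs) x hx).hasDerivAt (Icc_mem_nhds hs.1 hs.2))
      ((hf'_cont.comp (by fun_prop : ContinuousOn (fun s : ℝ => (s, x)) (Icc a b))
        fun s hs => ⟨hs, hx⟩).intervalIntegrable_of_Icc hab)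
  rw [← integral_sub (hint b (right_mem_Icc.2 hab)) (hint a (left_mem_Icc.2 hab))]
  calc ∫ x in c..d, (f b x - f a x) = ∫ x in c..d, ∫ s in a..b, f' s x :=
        integral_congr fun x hx => (hFTC x (by rwa [uIcc_of_le hcd] at hx)).symm
    _ = ∫ s in a..b, ∫ x in c..d, f' s x := by
        simp only [integral_of_le hab, integral_of_le hcd]
        refine integral_integral_swap ?_
        rw [Measure.prod_restrict]
        refine IntegrableOn.mono_set (t := Icc c d ×ˢ Icc a b) ?_
          (prod_mono Ioc_subset_Icc_self Ioc_subset_Icc_self)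
        exact (hf'_cont.comp continuous_swap.continuousOn fun p hp => ⟨hp.2, hp.1⟩)
          |>.integrableOn_compact (isCompact_Icc.prod isCompact_Icc)

/-- The derivative of a periodic function is periodic. -/
theorem periodic_of_hasDerivAt {f f' : ℝ → ℝ} {P : ℝ} (hf : ∀ x, f (x + P) = f x)
    (hf' : ∀ x, HasDerivAt f (f' x) x) (x : ℝ) : f' (x + P) = f' x := by
  have h := (hf' (x + P)).comp_add_const x P
  simp only [hf] at h
  exact h.unique (hf' x)

/-- Value function identity for the tracer mean field game in one space dimension:
if `φ` solves the backward Hamilton–Jacobi equation with terminal datum `-G` and `ρ`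
solves the forward Fokker–Planck equation with drift `u + ∂ₓφ`, then the total cost
equals `-∫₀ᴾ ρ(t,·) φ(t,·)`. -/
theorem mfg1_value_function_identity
    (D P t T : ℝ) (hD : 0 ≤ D) (hP : 0 < P) (htT : t < T)
    (u F : ℝ → ℝ → ℝ) (G : ℝ → ℝ)
    (hu_cont : ContinuousOn (fun p : ℝ × ℝ => u p.1 p.2) (Icc t T ×ˢ univ))
    (hF_cont : ContinuousOn (fun p : ℝ × ℝ => F p.1 p.2) (Icc t T ×ˢ univ))
    (hu_per : ∀ s x, u s (x + P) = u s x)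
    (hF_per : ∀ s x, F s (x + P) = F s x)
    (hG_cont : Continuous G) (hG_per : ∀ x, G (x + P) = G x)
    -- the adjoint function φ, C¹ in time and C² in space, periodic in space
    (φ φs φx φxx : ℝ → ℝ → ℝ)
    (hφs : ∀ s ∈ Icc t T, ∀ x : ℝ,
      HasDerivWithinAt (fun τ => φ τ x) (φs s x) (Icc t T) s)
    (hφx : ∀ s ∈ Icc t T, ∀ x : ℝ, HasDerivAt (fun y => φ s y) (φx s x) x)
    (hφxx : ∀ s ∈ Icc t T, ∀ x : ℝ, HasDerivAt (fun y => φx s y) (φxx s x) x)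
    (hφs_cont : ContinuousOn (fun p : ℝ × ℝ => φs p.1 p.2) (Icc t T ×ˢ univ))
    (hφx_cont : ContinuousOn (fun p : ℝ × ℝ => φx p.1 p.2) (Icc t T ×ˢ univ))
    (hφxx_cont : ContinuousOn (fun p : ℝ × ℝ => φxx p.1 p.2) (Icc t T ×ˢ univ))
    (hφ_per : ∀ s x, φ s (x + P) = φ s x)
    -- backward Hamilton–Jacobi equation with terminal condition φ(T,·) = -G
    (hφ_hje : ∀ s ∈ Icc t T, ∀ x : ℝ,
      φs s x + (1 / 2) * (φx s x) ^ 2 + u s x * φx s x + D * φxx s x = F s x)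
    (hφ_term : ∀ x, φ T x = -G x)
    -- the density ρ, C¹ in time and C² in space, periodic in space
    (ρ ρs ρx ρxx : ℝ → ℝ → ℝ)
    (hρs : ∀ s ∈ Icc t T, ∀ x : ℝ,
      HasDerivWithinAt (fun τ => ρ τ x) (ρs s x) (Icc t T) s)
    (hρx : ∀ s ∈ Icc t T, ∀ x : ℝ, HasDerivAt (fun y => ρ s y) (ρx s x) x)
    (hρxx : ∀ s ∈ Icc t T, ∀ x : ℝ, HasDerivAt (fun y => ρx s y) (ρxx s x) x)
    (hρs_cont : ContinuousOn (fun p : ℝ × ℝ => ρs p.1 p.2) (Icc t T ×ˢ univ))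
    (hρx_cont : ContinuousOn (fun p : ℝ × ℝ => ρx p.1 p.2) (Icc t T ×ˢ univ))
    (hρxx_cont : ContinuousOn (fun p : ℝ × ℝ => ρxx p.1 p.2) (Icc t T ×ˢ univ))
    (hρ_per : ∀ s x, ρ s (x + P) = ρ s x)
    -- forward Fokker–Planck equation ∂ₛρ + ∂ₓ((u + ∂ₓφ)ρ) = D ∂ₓ²ρ
    (hρ_pde : ∀ s ∈ Icc t T, ∀ x : ℝ,
      HasDerivAt (fun y => (u s y + φx s y) * ρ s y)
        (D * ρxx s x - ρs s x) x) :
    (∫ x in (0:ℝ)..P, G x * ρ T x) +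
        (∫ s in t..T, ∫ x in (0:ℝ)..P,
          ((1 / 2) * (φx s x) ^ 2 + F s x) * ρ s x) =
      -(∫ x in (0:ℝ)..P, ρ t x * φ t x) := by
  have hsub : Icc t T ×ˢ Icc 0 P ⊆ Icc t T ×ˢ (univ : Set ℝ) :=
    prod_mono Subset.rfl (subset_univ _)
  have hφ_cont : ContinuousOn (fun p : ℝ × ℝ => φ p.1 p.2) (Icc t T ×ˢ Icc 0 P) :=
    continuousOn_rectangle_of_hasDerivWithinAt (fun s hs x _ => hφs s hs x)
      (hφs_cont.mono hsub) fun s hs x _ => (hφx s hs x).continuousAt.continuousWithinAt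
  have hρ_cont : ContinuousOn (fun p : ℝ × ℝ => ρ p.1 p.2) (Icc t T ×ˢ Icc 0 P) :=
    continuousOn_rectangle_of_hasDerivWithinAt (fun s hs x _ => hρs s hs x)
      (hρs_cont.mono hsub) fun s hs x _ => (hρx s hs x).continuousAt.continuousWithinAt
  have hslice : ∀ {f : ℝ → ℝ → ℝ},
      ContinuousOn (fun p : ℝ × ℝ => f p.1 p.2) (Icc t T ×ˢ Icc 0 P) →
      ∀ s ∈ Icc t T, IntervalIntegrable (f s) volume 0 P := fun hf s hs =>
    (hf.comp (by fun_prop : ContinuousOn (fun x : ℝ => (s, x)) (Icc 0 P))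
      fun x hx => ⟨hs, hx⟩).intervalIntegrable_of_Icc hP.le
  have hdt_cont : ContinuousOn
      (fun p : ℝ × ℝ => ρs p.1 p.2 * φ p.1 p.2 + ρ p.1 p.2 * φs p.1 p.2)
      (Icc t T ×ˢ Icc 0 P) :=
    ((hρs_cont.mono hsub).mul hφ_cont).add (hρ_cont.mul (hφs_cont.mono hsub))
  have hcost_cont : ContinuousOn
      (fun p : ℝ × ℝ => ((1 / 2) * (φx p.1 p.2) ^ 2 + F p.1 p.2) * ρ p.1 p.2)
      (Icc t T ×ˢ Icc 0 P) :=
    ((continuousOn_const.mul ((hφx_cont.mono hsub).pow 2)).add (hF_cont.mono hsub)).mul hρ_cont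
  have htime := integral_sub_integral_eq_integral_integral_deriv htT.le hP.le
    (f := fun s x => ρ s x * φ s x) (f' := fun s x => ρs s x * φ s x + ρ s x * φs s x)
    (fun s hs x _ => (hρs s hs x).mul (hφs s hs x)) hdt_cont
    (fun s hs x _ => ((hρx s hs x).mul (hφx s hs x)).continuousAt.continuousWithinAt)
  have hspace : ∀ s ∈ Icc t T, ∫ x in (0:ℝ)..P, (ρs s x * φ s x + ρ s x * φs s x) =
      ∫ x in (0:ℝ)..P, ((1 / 2) * (φx s x) ^ 2 + F s x) * ρ s x := by
    intro s hs
    -- the integrands differ by the derivative of a periodic flux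
    have hflux : ∀ x, HasDerivAt
        (fun y => D * (φ s y * ρx s y - φx s y * ρ s y) - φ s y * ((u s y + φx s y) * ρ s y))
        ((ρs s x * φ s x + ρ s x * φs s x) - ((1 / 2) * (φx s x) ^ 2 + F s x) * ρ s x) x := by
      intro x
      refine (((((hφx s hs x).mul (hρxx s hs x)).sub
        ((hφxx s hs x).mul (hρx s hs x))).const_mul D).sub
        ((hφx s hs x).mul (hρ_pde s hs x))).congr_deriv ?_
      rw [← hφ_hje s hs x]
      ring
    have hint_dt := hslice (f := fun s x => ρs s x * φ s x + ρ s x * φs s x) hdt_cont s hs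
    have hint_cost := hslice (f := fun s x => ((1 / 2) * (φx s x) ^ 2 + F s x) * ρ s x)
      hcost_cont s hs
    rw [← sub_eq_zero, ← integral_sub hint_dt hint_cost,
      integral_eq_sub_of_hasDerivAt (fun x _ => hflux x) (hint_dt.sub hint_cost)]
    have hφ0 := hφ_per s 0
    have hρ0 := hρ_per s 0
    have hu0 := hu_per s 0
    have hφx0 := periodic_of_hasDerivAt (hφ_per s) (hφx s hs) 0
    have hρx0 := periodic_of_hasDerivAt (hρ_per s) (hρx s hs) 0
    rw [zero_add] at hφ0 hρ0 hu0 hφx0 hρx0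
    rw [hφ0, hρ0, hu0, hφx0, hρx0, sub_self]
  rw [integral_congr fun s hs => hspace s (by rwa [uIcc_of_le htT.le] at hs)] at htime
  have hterm : ∫ x in (0:ℝ)..P, ρ T x * φ T x = -∫ x in (0:ℝ)..P, G x * ρ T x := by
    rw [← intervalIntegral.integral_neg]
    exact integral_congr fun x _ => by simp only [hφ_term]; ring
  linarith
end

section
/- Integration-by-parts identity used in the value-function derivation: Let D ≥ 0, P > 0 and t < T. Let u, F : [t,T] × ℝ → ℝ be continuous and P-periodic in space, and G : ℝ → ℝ continuous and P-periodic. Let φ, ρ : [t,T] × ℝ → ℝ be C¹ in time and C² in space with continuous derivatives and P-periodic in space, with terminal condition φ(T,·) = −G, and suppose ρ solves ∂_sρ + ∂_x((u + ∂_xφ)ρ) = D ∂_x²ρ on [t,T] × ℝ (no equation is imposed on φ other than the terminal condition). Then ∫_t^T ∫₀^P ρ(s,x) [∂_sφ + (1/2)(∂_xφ)² + u ∂_xφ + D ∂_x²φ − F](s,x) dx ds = −∫₀^P G(x) ρ(T,x) dx − ∫₀^P ρ(t,x) φ(t,x) dx − ∫_t^T ∫₀^P ((1/2)(∂_xφ(s,x))²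 + F(s,x)) ρ(s,x) dx ds. -/
open Set MeasureTheory intervalIntegral

/-- A primitive in the second variable of a function continuous on `S × ℝ` is jointly continuous. -/
theorem continuousOn_parametric_primitive {S : Set ℝ} {f : ℝ → ℝ → ℝ} (a : ℝ)
    (hf : ContinuousOn (fun p : ℝ × ℝ => f p.1 p.2) (S ×ˢ univ)) :
    ContinuousOn (fun p : ℝ × ℝ => ∫ y in a..p.2, f p.1 y) (S ×ˢ univ) := by
  have hS : Continuous (Function.uncurry fun (s : S) (y : ℝ) => f s y) :=
    hf.comp_continuous (f := fun q : S × ℝ => ((q.1 : ℝ), q.2)) (by fun_prop)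
      fun q => ⟨q.1.2, mem_univ _⟩
  have hI := continuous_parametric_primitive_of_continuous (μ := volume) (a₀ := a) hS
  rw [continuousOn_iff_continuous_domRestrict]
  exact hI.comp (f := fun p : ↥(S ×ˢ (univ : Set ℝ)) => ((⟨p.1.1, p.2.1⟩ : S), p.1.2))
    (by fun_prop)

/-- The integral over a fixed interval of a function continuous on `S × ℝ` depends continuously on
the parameter. -/
theorem continuousOn_integral_of_continuousOn_prod {S : Set ℝ} {f : ℝ → ℝ → ℝ} (a b : ℝ)
    (hf : ContinuousOn (fun p : ℝ × ℝ => f p.1 p.2) (S ×ˢ univ)) :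
    ContinuousOn (fun s => ∫ y in a..b, f s y) S :=
  (continuousOn_parametric_primitive a hf).comp (f := fun s => (s, b)) (by fun_prop)
    fun _ hs => ⟨hs, mem_univ _⟩

/-- Slices of a function continuous on `S × ℝ` are continuous. -/
theorem continuous_slice_of_continuousOn_prod {S : Set ℝ} {f : ℝ × ℝ → ℝ} {s : ℝ} (hs : s ∈ S)
    (hf : ContinuousOn f (S ×ˢ univ)) : Continuous fun y => f (s, y) :=
  hf.comp_continuous (f := fun y => (s, y)) (by fun_prop) fun _ => ⟨hs, mem_univ _⟩

/-- A function continuous in the first variable, with a space derivative that is jointly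
continuous on `S × ℝ`, is jointly continuous there. -/
theorem continuousOn_prod_of_hasDerivAt_snd {S : Set ℝ} {f fx : ℝ → ℝ → ℝ}
    (hf : ∀ x, ContinuousOn (fun s => f s x) S)
    (hfx : ∀ s ∈ S, ∀ x, HasDerivAt (f s) (fx s x) x)
    (hfx_cont : ContinuousOn (fun p : ℝ × ℝ => fx p.1 p.2) (S ×ˢ univ)) :
    ContinuousOn (fun p : ℝ × ℝ => f p.1 p.2) (S ×ˢ univ) := by
  have h0 : ContinuousOn (fun p : ℝ × ℝ => f p.1 0) (S ×ˢ univ) :=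
    (hf 0).comp (f := Prod.fst) (by fun_prop) fun _ hp => hp.1
  refine (h0.add (continuousOn_parametric_primitive 0 hfx_cont)).congr fun p hp => ?_
  have hint := integral_eq_sub_of_hasDerivAt (a := 0) (b := p.2) (fun x _ => hfx p.1 hp.1 x)
    ((continuous_slice_of_continuousOn_prod hp.1 hfx_cont).intervalIntegrable _ _)
  simp [hint]

/-- Integrating a time derivative over a space-time rectangle gives the difference of the space
integrals at the final and initial times. -/
theorem integral_integral_time_deriv {a b t T : ℝ} (htT : t ≤ T) {f fs : ℝ → ℝ → ℝ}
    (hfs : ∀ s ∈ Icc t T, ∀ x, HasDerivWithinAt (fun τ => f τ x) (fs s x) (Icc t T) s)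
    (hf_cont : ContinuousOn (fun p : ℝ × ℝ => f p.1 p.2) (Icc t T ×ˢ univ))
    (hfs_cont : ContinuousOn (fun p : ℝ × ℝ => fs p.1 p.2) (Icc t T ×ˢ univ)) :
    ∫ s in t..T, ∫ x in a..b, fs s x = (∫ x in a..b, f T x) - ∫ x in a..b, f t x := by
  have hint : IntegrableOn (Function.uncurry fs) (uIoc t T ×ˢ uIoc a b) := by
    have hK : IntegrableOn (Function.uncurry fs) (Icc t T ×ˢ uIcc a b) :=
      (hfs_cont.mono (prod_mono subset_rfl (subset_univ _))).integrableOn_compact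
        (isCompact_Icc.prod isCompact_uIcc)
    refine hK.mono_set (prod_mono ?_ uIoc_subset_uIcc)
    rw [uIoc_of_le htT]
    exact Ioc_subset_Icc_self
  rw [intervalIntegral_intervalIntegral_swap hint, ← intervalIntegral.integral_sub
    ((continuous_slice_of_continuousOn_prod (right_mem_Icc.2 htT) hf_cont).intervalIntegrable _ _)
    ((continuous_slice_of_continuousOn_prod (left_mem_Icc.2 htT) hf_cont).intervalIntegrable _ _)]
  refine intervalIntegral.integral_congr fun x _ => ?_
  have hx : ContinuousOn (fun s => fs s x) (Icc t T) :=
    hfs_cont.comp (f := fun s => (s, x)) (by fun_prop) fun _ hs => ⟨hs, mem_univ _⟩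
  refine integral_eq_sub_of_hasDerivAt_of_le htT (fun s hs => (hfs s hs x).continuousWithinAt)
    (fun s hs => (hfs s (Ioo_subset_Icc_self hs) x).hasDerivAt (Icc_mem_nhds hs.1 hs.2)) ?_
  exact ContinuousOn.intervalIntegrable_of_Icc htT hx

/-- The derivative of a periodic function is periodic. -/
theorem periodic_of_hasDerivAt_of_periodic {f f' : ℝ → ℝ} {P : ℝ} (hf : Function.Periodic f P)
    (hf' : ∀ x, HasDerivAt f (f' x) x) : Function.Periodic f' P := by
  intro x
  have h := (hf' (x + P)).comp_add_const x P
  simp only [hf _] at h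
  exact h.unique (hf' x)

/-- Integration-by-parts identity used in the value-function derivation: if `ρ`
solves the forward Fokker–Planck equation with drift `u + ∂ₓφ` and `φ(T,·) = -G`
(no equation being imposed on `φ` itself), then
`∫ₜᵀ∫₀ᴾ ρ (∂ₛφ + (1/2)(∂ₓφ)² + u ∂ₓφ + D ∂ₓ²φ - F)
  = -∫₀ᴾ G ρ(T,·) - ∫₀ᴾ ρ(t,·) φ(t,·) - ∫ₜᵀ∫₀ᴾ ((1/2)(∂ₓφ)² + F) ρ`. -/
theorem mfg1_integration_by_parts_identity
    (D P t T : ℝ) (hD : 0 ≤ D) (hP : 0 < P) (htT : t < T)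
    (u F : ℝ → ℝ → ℝ) (G : ℝ → ℝ)
    (hu_cont : ContinuousOn (fun p : ℝ × ℝ => u p.1 p.2) (Icc t T ×ˢ univ))
    (hF_cont : ContinuousOn (fun p : ℝ × ℝ => F p.1 p.2) (Icc t T ×ˢ univ))
    (hu_per : ∀ s x, u s (x + P) = u s x)
    (hF_per : ∀ s x, F s (x + P) = F s x)
    (hG_cont : Continuous G) (hG_per : ∀ x, G (x + P) = G x)
    -- φ, C¹ in time and C² in space, periodic in space, terminal datum -G
    (φ φs φx φxx : ℝ → ℝ → ℝ)
    (hφs : ∀ s ∈ Icc t T, ∀ x : ℝ,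
      HasDerivWithinAt (fun τ => φ τ x) (φs s x) (Icc t T) s)
    (hφx : ∀ s ∈ Icc t T, ∀ x : ℝ, HasDerivAt (fun y => φ s y) (φx s x) x)
    (hφxx : ∀ s ∈ Icc t T, ∀ x : ℝ, HasDerivAt (fun y => φx s y) (φxx s x) x)
    (hφs_cont : ContinuousOn (fun p : ℝ × ℝ => φs p.1 p.2) (Icc t T ×ˢ univ))
    (hφx_cont : ContinuousOn (fun p : ℝ × ℝ => φx p.1 p.2) (Icc t T ×ˢ univ))
    (hφxx_cont : ContinuousOn (fun p : ℝ × ℝ => φxx p.1 p.2) (Icc t T ×ˢ univ))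
    (hφ_per : ∀ s x, φ s (x + P) = φ s x)
    (hφ_term : ∀ x, φ T x = -G x)
    -- ρ, C¹ in time and C² in space, periodic in space
    (ρ ρs ρx ρxx : ℝ → ℝ → ℝ)
    (hρs : ∀ s ∈ Icc t T, ∀ x : ℝ,
      HasDerivWithinAt (fun τ => ρ τ x) (ρs s x) (Icc t T) s)
    (hρx : ∀ s ∈ Icc t T, ∀ x : ℝ, HasDerivAt (fun y => ρ s y) (ρx s x) x)
    (hρxx : ∀ s ∈ Icc t T, ∀ x : ℝ, HasDerivAt (fun y => ρx s y) (ρxx s x) x)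
    (hρs_cont : ContinuousOn (fun p : ℝ × ℝ => ρs p.1 p.2) (Icc t T ×ˢ univ))
    (hρx_cont : ContinuousOn (fun p : ℝ × ℝ => ρx p.1 p.2) (Icc t T ×ˢ univ))
    (hρxx_cont : ContinuousOn (fun p : ℝ × ℝ => ρxx p.1 p.2) (Icc t T ×ˢ univ))
    (hρ_per : ∀ s x, ρ s (x + P) = ρ s x)
    -- forward Fokker–Planck equation ∂ₛρ + ∂ₓ((u + ∂ₓφ)ρ) = D ∂ₓ²ρ
    (hρ_pde : ∀ s ∈ Icc t T, ∀ x : ℝ,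
      HasDerivAt (fun y => (u s y + φx s y) * ρ s y)
        (D * ρxx s x - ρs s x) x) :
    (∫ s in t..T, ∫ x in (0:ℝ)..P,
        ρ s x * (φs s x + (1 / 2) * (φx s x) ^ 2 + u s x * φx s x
          + D * φxx s x - F s x)) =
      -(∫ x in (0:ℝ)..P, G x * ρ T x) - (∫ x in (0:ℝ)..P, ρ t x * φ t x)
        - (∫ s in t..T, ∫ x in (0:ℝ)..P,
            ((1 / 2) * (φx s x) ^ 2 + F s x) * ρ s x) := by
  have hφ_cont := continuousOn_prod_of_hasDerivAt_snd
    (fun x s hs => (hφs s hs x).continuousWithinAt) hφx hφx_cont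
  have hρ_cont := continuousOn_prod_of_hasDerivAt_snd
    (fun x s hs => (hρs s hs x).continuousWithinAt) hρx hρx_cont
  have h_backward_cont : ContinuousOn (fun p : ℝ × ℝ => ρ p.1 p.2 * (φs p.1 p.2
      + (1 / 2) * (φx p.1 p.2) ^ 2 + u p.1 p.2 * φx p.1 p.2 + D * φxx p.1 p.2 - F p.1 p.2))
      (Icc t T ×ˢ univ) := by fun_prop
  have h_cost_cont : ContinuousOn (fun p : ℝ × ℝ =>
      ((1 / 2) * (φx p.1 p.2) ^ 2 + F p.1 p.2) * ρ p.1 p.2) (Icc t T ×ˢ univ) := by fun_prop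
  have h_time_cont : ContinuousOn (fun p : ℝ × ℝ =>
      ρs p.1 p.2 * φ p.1 p.2 + ρ p.1 p.2 * φs p.1 p.2) (Icc t T ×ˢ univ) := by fun_prop
  have h_flux_cont : ContinuousOn (fun p : ℝ × ℝ =>
      D * (ρxx p.1 p.2 * φ p.1 p.2 - ρ p.1 p.2 * φxx p.1 p.2)
        - ((D * ρxx p.1 p.2 - ρs p.1 p.2) * φ p.1 p.2
          + (u p.1 p.2 + φx p.1 p.2) * ρ p.1 p.2 * φx p.1 p.2)) (Icc t T ×ˢ univ) := by fun_prop
  have h_flux : ∀ s ∈ Icc t T, ∫ x in (0:ℝ)..P,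
      (D * (ρxx s x * φ s x - ρ s x * φxx s x)
        - ((D * ρxx s x - ρs s x) * φ s x + (u s x + φx s x) * ρ s x * φx s x)) = 0 := by
    intro s hs
    have hderiv : ∀ x : ℝ, HasDerivAt
        (fun y => D * (ρx s y * φ s y - ρ s y * φx s y) - (u s y + φx s y) * ρ s y * φ s y)
        (D * (ρxx s x * φ s x - ρ s x * φxx s x)
          - ((D * ρxx s x - ρs s x) * φ s x + (u s x + φx s x) * ρ s x * φx s x)) x := by
      intro x
      refine (((((hρxx s hs x).mul (hφx s hs x)).sub
        ((hρx s hs x).mul (hφxx s hs x))).const_mul D).sub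
        ((hρ_pde s hs x).mul (hφx s hs x))).congr_deriv ?_
      ring
    have hint := (continuous_slice_of_continuousOn_prod hs h_flux_cont).intervalIntegrable
      (μ := volume) 0 P
    rw [integral_eq_sub_of_hasDerivAt (fun x _ => hderiv x) hint,
      (periodic_of_hasDerivAt_of_periodic (hφ_per s) (hφx s hs)).eq,
      (periodic_of_hasDerivAt_of_periodic (hρ_per s) (hρx s hs)).eq,
      Function.Periodic.eq (hφ_per s), Function.Periodic.eq (hρ_per s),
      Function.Periodic.eq (hu_per s), sub_self]
  have h_time := integral_integral_time_deriv (a := 0) (b := P) htT.le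
    (f := fun s x => ρ s x * φ s x) (fun s hs x => (hρs s hs x).mul (hφs s hs x))
    (hρ_cont.mul hφ_cont) h_time_cont
  have h_split : (∫ s in t..T, ∫ x in (0:ℝ)..P,
        ρ s x * (φs s x + (1 / 2) * (φx s x) ^ 2 + u s x * φx s x + D * φxx s x - F s x))
      + (∫ s in t..T, ∫ x in (0:ℝ)..P, ((1 / 2) * (φx s x) ^ 2 + F s x) * ρ s x)
      = ∫ s in t..T, ∫ x in (0:ℝ)..P, (ρs s x * φ s x + ρ s x * φs s x) := by
    rw [← intervalIntegral.integral_add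
      ((continuousOn_integral_of_continuousOn_prod 0 P
        h_backward_cont).intervalIntegrable_of_Icc htT.le)
      ((continuousOn_integral_of_continuousOn_prod 0 P
        h_cost_cont).intervalIntegrable_of_Icc htT.le)]
    refine intervalIntegral.integral_congr fun s hs => ?_
    rw [uIcc_of_le htT.le] at hs
    have h_slice {f : ℝ × ℝ → ℝ} (hf : ContinuousOn f (Icc t T ×ˢ univ)) :
        IntervalIntegrable (fun x => f (s, x)) volume 0 P :=
      (continuous_slice_of_continuousOn_prod hs hf).intervalIntegrable _ _
    have h_sub := intervalIntegral.integral_sub (h_slice h_time_cont) (h_slice h_flux_cont)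
    rw [h_flux s hs, sub_zero] at h_sub
    rw [← intervalIntegral.integral_add (h_slice h_backward_cont) (h_slice h_cost_cont), ← h_sub]
    refine intervalIntegral.integral_congr fun x _ => ?_
    dsimp only
    ring
  have h_term : ∫ x in (0:ℝ)..P, ρ T x * φ T x = -∫ x in (0:ℝ)..P, G x * ρ T x := by
    rw [← intervalIntegral.integral_neg]
    refine intervalIntegral.integral_congr fun x _ => ?_
    simp only [hφ_term]
    ring
  simp only [h_term] at h_time
  linarith
end

section
/- One-dimensional version of the link between the decoupled and coupled mean field game systems (Theorem 4.5): Let D > 0, P > 0 and t < T. Let q, φ, q̃, φ̃ : [t,T] × ℝ → ℝ be C¹ in time and C² in space with continuous derivatives and P-periodic in space, let F : [t,T] × ℝ → ℝ be continuous and P-periodic in space, and G : ℝ → ℝ continuous and P-periodic. For each s ∈ [t,T], let u(s,·) be the unique C¹ P-periodic zero-mean function with ∂_x u(s,x) = q(s,x) − (1/P)∫₀^P q(s,y) dy, and w(s,·) the unique C¹ P-periodic zero-mean function with ∂_x w(s,x) = q(s,x)∂_xφ(s,x) − (1/P)∫₀^P q(s,y)∂_xφ(s,y) dy; assume ∂_x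 b is continuous and bounded for the drift b = u + ∂_xφ̃. Suppose: (i) the pair (q, φ) solves the coupled system ∂_s q + ∂_x((u + ∂_xφ)q) = D ∂_x² q and ∂_sφ + (1/2)(∂_xφ)² + u ∂_xφ − w + D ∂_x²φ = F on [t,T] × ℝ with φ(T,·) = −G; (ii) the pair (q̃, φ̃) solves the decoupled system ∂_s q̃ + ∂_x((u + ∂_xφ̃)q̃) = D ∂_x² q̃ and ∂_sφ̃ + (1/2)(∂_xφ̃)² + u ∂_xφ̃ + D ∂_x²φ̃ = F + w on [t,T] × ℝ with q̃(t,·) = q(t,·) and φ̃(T,·) = −G; and (iii) any two functions that are C¹ in time and C² in space with continuous derivatives, P-periodic in space, and solve the backward terminal value problem for φ̃ in (ii) coincide. Then q̃ = q and φ̃ = φ on [t,T] × ℝ. -/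
open Set MeasureTheory intervalIntegral

/-- The derivative of a function at a maximum over `[t, T]` attained after the left endpoint is
nonnegative. -/
lemma hasDerivWithinAt_nonneg_of_isMaxOn_Icc {f : ℝ → ℝ} {f' t T s : ℝ} (hs : s ∈ Ioc t T)
    (hmax : IsMaxOn f (Icc t T) s) (hf : HasDerivWithinAt f f' (Icc t T) s) : 0 ≤ f' := by
  have hseg : segment ℝ s t ⊆ Icc t T :=
    (convex_Icc t T).segment_subset ⟨hs.1.le, hs.2⟩ ⟨le_rfl, hs.1.le.trans hs.2⟩
  have h := hmax.localize.hasFDerivWithinAt_nonpos hf.hasFDerivWithinAt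
    (sub_mem_posTangentConeAt_of_segment_subset hseg)
  simp only [ContinuousLinearMap.toSpanSingleton_apply, smul_eq_mul] at h
  nlinarith [hs.1]

/-- The second derivative is nonpositive at a local maximum. -/
lemma second_deriv_nonpos_of_isLocalMax {f f' : ℝ → ℝ} {f'' x : ℝ}
    (hf : ∀ y, HasDerivAt f (f' y) y) (hf' : HasDerivAt f' f'' x) (hmax : IsLocalMax f x) :
    f'' ≤ 0 := by
  have hderiv : deriv f = f' := funext fun y => (hf y).deriv
  by_contra! hpos
  have hmin : IsLocalMin f x := by
    refine isLocalMin_of_deriv_deriv_pos ?_ hmax.deriv_eq_zero (hf x).continuousAt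
    rwa [hderiv, hf'.deriv]
  have hconst : f =ᶠ[nhds x] fun _ => f x := by
    filter_upwards [hmax, hmin] with y h₁ h₂ using le_antisymm h₁ h₂
  have hzero := hconst.deriv.deriv_eq
  rw [hderiv, hf'.deriv] at hzero
  simp at hzero
  exact hpos.ne' hzero

/-- Weak maximum principle for the periodic linear advection–diffusion equation
`∂ₛr = D ∂ₓ²r - b ∂ₓr - c r` with bounded zeroth-order coefficient: a classical solution with
nonpositive initial data stays nonpositive. -/
lemma periodic_advection_diffusion_nonpos {D P t T M : ℝ} (hD : 0 ≤ D) (hP : 0 < P)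
    {r rs rx rxx b c : ℝ → ℝ → ℝ}
    (hrs : ∀ s ∈ Icc t T, ∀ x, HasDerivWithinAt (fun τ => r τ x) (rs s x) (Icc t T) s)
    (hrx : ∀ s ∈ Icc t T, ∀ x, HasDerivAt (r s) (rx s x) x)
    (hrxx : ∀ s ∈ Icc t T, ∀ x, HasDerivAt (rx s) (rxx s x) x)
    (hrs_cont : ContinuousOn (fun p : ℝ × ℝ => rs p.1 p.2) (Icc t T ×ˢ univ))
    (hper : ∀ s, Function.Periodic (r s) P)
    (hc : ∀ s ∈ Icc t T, ∀ x, |c s x| ≤ M)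
    (hpde : ∀ s ∈ Icc t T, ∀ x, rs s x = D * rxx s x - b s x * rx s x - c s x * r s x)
    (hinit : ∀ x, r t x ≤ 0) :
    ∀ s ∈ Icc t T, ∀ x, r s x ≤ 0 := by
  intro s₁ hs₁ x₁
  by_contra! hpos
  obtain ⟨K, hK⟩ := (isCompact_Icc.prod isCompact_Icc).exists_bound_of_continuousOn
    (hrs_cont.mono (prod_mono_right (subset_univ (Icc 0 P))))
  have hr_cont : ContinuousOn (fun p : ℝ × ℝ => r p.1 p.2) (Icc t T ×ˢ Icc 0 P) := by
    refine continuousOn_prod_of_continuousOn_lipschitzOnWith _ K.toNNReal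
      (fun s hs x _ => (hrx s hs x).continuousAt.continuousWithinAt) fun x hx => ?_
    refine (convex_Icc t T).lipschitzOnWith_of_nnnorm_hasDerivWithin_le
      (fun s hs => hrs s hs x) fun s hs => ?_
    rw [← NNReal.coe_le_coe, coe_nnnorm]
    exact (hK (s, x) ⟨hs, hx⟩).trans (Real.le_coe_toNNReal K)
  have hexp_cont : ContinuousOn (fun p : ℝ × ℝ => Real.exp (-(M + 1) * p.1) * r p.1 p.2)
      (Icc t T ×ˢ Icc 0 P) := (by fun_prop : Continuous fun p : ℝ × ℝ =>
        Real.exp (-(M + 1) * p.1)).continuousOn.mul hr_cont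
  obtain ⟨⟨s₀, x₀⟩, ⟨hs₀, -⟩, hmax⟩ := (isCompact_Icc.prod isCompact_Icc).exists_isMaxOn
    ⟨(s₁, 0), hs₁, left_mem_Icc.2 hP.le⟩ hexp_cont
  dsimp only at hs₀
  have hmax_global : ∀ s ∈ Icc t T, ∀ x,
      Real.exp (-(M + 1) * s) * r s x ≤ Real.exp (-(M + 1) * s₀) * r s₀ x₀ := by
    intro s hs x
    obtain ⟨y, hy, hxy⟩ := (hper s).exists_mem_Ico₀ hP x
    rw [hxy]
    exact hmax (show (s, y) ∈ Icc t T ×ˢ Icc 0 P from ⟨hs, Ico_subset_Icc_self hy⟩)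
  have hr_pos : 0 < r s₀ x₀ := pos_of_mul_pos_right
    ((mul_pos (Real.exp_pos _) hpos).trans_le (hmax_global s₁ hs₁ x₁)) (Real.exp_pos _).le
  have hs₀t : t < s₀ := by
    refine lt_of_le_of_ne hs₀.1 fun h => ?_
    rw [← h] at hr_pos
    exact (hinit x₀).not_gt hr_pos
  have hlocal : IsLocalMax (r s₀) x₀ := Filter.Eventually.of_forall fun x =>
    le_of_mul_le_mul_left (hmax_global s₀ hs₀ x) (Real.exp_pos _)
  have hrx₀ : rx s₀ x₀ = 0 := hlocal.hasDerivAt_eq_zero (hrx s₀ hs₀ x₀)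
  have hrxx₀ : rxx s₀ x₀ ≤ 0 :=
    second_deriv_nonpos_of_isLocalMax (hrx s₀ hs₀) (hrxx s₀ hs₀ x₀) hlocal
  have hexp : HasDerivAt (fun s => Real.exp (-(M + 1) * s))
      (Real.exp (-(M + 1) * s₀) * (-(M + 1))) s₀ := by
    simpa using ((hasDerivAt_id s₀).const_mul (-(M + 1))).exp
  have htime := hasDerivWithinAt_nonneg_of_isMaxOn_Icc ⟨hs₀t, hs₀.2⟩
    (fun s hs => hmax_global s hs x₀) (hexp.hasDerivWithinAt.mul (hrs s₀ hs₀ x₀))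
  have htime' : 0 ≤ rs s₀ x₀ - (M + 1) * r s₀ x₀ := by
    refine nonneg_of_mul_nonneg_right (a := Real.exp (-(M + 1) * s₀)) ?_ (Real.exp_pos _)
    linarith
  rw [hpde s₀ hs₀ x₀, hrx₀] at htime'
  nlinarith [mul_nonpos_of_nonneg_of_nonpos hD hrxx₀,
    mul_nonneg (neg_le_iff_add_nonneg.1 (abs_le.1 (hc s₀ hs₀ x₀)).1) hr_pos.le]

/-- One-dimensional version of the link between the decoupled and coupled mean field
game systems (Theorem 4.5): if `(q, φ)` solves the coupled MFG-2 system and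
`(q̃, φ̃)` solves the modified decoupled system with frozen inputs `(q, φ)`, the same
initial vorticity and the same terminal data, and the decoupled backward terminal
value problem has at most one classical spatially periodic solution, then `q̃ = q`
and `φ̃ = φ` on `[t,T] × ℝ`. -/
theorem mfg2_decoupled_coupled_link
    (D P t T : ℝ) (hD : 0 < D) (hP : 0 < P) (htT : t < T)
    (F : ℝ → ℝ → ℝ) (G : ℝ → ℝ)
    (hF_cont : ContinuousOn (fun p : ℝ × ℝ => F p.1 p.2) (Icc t T ×ˢ univ))
    (hF_per : ∀ s x, F s (x + P) = F s x)
    (hG_cont : Continuous G) (hG_per : ∀ x, G (x + P) = G x)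
    -- the coupled vorticity q, C¹ in time and C² in space, periodic in space
    (q qs qx qxx : ℝ → ℝ → ℝ)
    (hqs : ∀ s ∈ Icc t T, ∀ x : ℝ,
      HasDerivWithinAt (fun τ => q τ x) (qs s x) (Icc t T) s)
    (hqx : ∀ s ∈ Icc t T, ∀ x : ℝ, HasDerivAt (fun y => q s y) (qx s x) x)
    (hqxx : ∀ s ∈ Icc t T, ∀ x : ℝ, HasDerivAt (fun y => qx s y) (qxx s x) x)
    (hqs_cont : ContinuousOn (fun p : ℝ × ℝ => qs p.1 p.2) (Icc t T ×ˢ univ))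
    (hqx_cont : ContinuousOn (fun p : ℝ × ℝ => qx p.1 p.2) (Icc t T ×ˢ univ))
    (hqxx_cont : ContinuousOn (fun p : ℝ × ℝ => qxx p.1 p.2) (Icc t T ×ˢ univ))
    (hq_per : ∀ s x, q s (x + P) = q s x)
    -- the coupled adjoint φ, C¹ in time and C² in space, periodic in space
    (φ φs φx φxx : ℝ → ℝ → ℝ)
    (hφs : ∀ s ∈ Icc t T, ∀ x : ℝ,
      HasDerivWithinAt (fun τ => φ τ x) (φs s x) (Icc t T) s)
    (hφx : ∀ s ∈ Icc t T, ∀ x : ℝ, HasDerivAt (fun y => φ s y) (φx s x) x)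
    (hφxx : ∀ s ∈ Icc t T, ∀ x : ℝ, HasDerivAt (fun y => φx s y) (φxx s x) x)
    (hφs_cont : ContinuousOn (fun p : ℝ × ℝ => φs p.1 p.2) (Icc t T ×ˢ univ))
    (hφx_cont : ContinuousOn (fun p : ℝ × ℝ => φx p.1 p.2) (Icc t T ×ˢ univ))
    (hφxx_cont : ContinuousOn (fun p : ℝ × ℝ => φxx p.1 p.2) (Icc t T ×ˢ univ))
    (hφ_per : ∀ s x, φ s (x + P) = φ s x)
    -- the decoupled vorticity q̃, C¹ in time and C² in space, periodic in space
    (qt qts qtx qtxx : ℝ → ℝ → ℝ)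
    (hqts : ∀ s ∈ Icc t T, ∀ x : ℝ,
      HasDerivWithinAt (fun τ => qt τ x) (qts s x) (Icc t T) s)
    (hqtx : ∀ s ∈ Icc t T, ∀ x : ℝ, HasDerivAt (fun y => qt s y) (qtx s x) x)
    (hqtxx : ∀ s ∈ Icc t T, ∀ x : ℝ, HasDerivAt (fun y => qtx s y) (qtxx s x) x)
    (hqts_cont : ContinuousOn (fun p : ℝ × ℝ => qts p.1 p.2) (Icc t T ×ˢ univ))
    (hqtx_cont : ContinuousOn (fun p : ℝ × ℝ => qtx p.1 p.2) (Icc t T ×ˢ univ))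
    (hqtxx_cont : ContinuousOn (fun p : ℝ × ℝ => qtxx p.1 p.2) (Icc t T ×ˢ univ))
    (hqt_per : ∀ s x, qt s (x + P) = qt s x)
    -- the decoupled adjoint φ̃, C¹ in time and C² in space, periodic in space
    (φt φts φtx φtxx : ℝ → ℝ → ℝ)
    (hφts : ∀ s ∈ Icc t T, ∀ x : ℝ,
      HasDerivWithinAt (fun τ => φt τ x) (φts s x) (Icc t T) s)
    (hφtx : ∀ s ∈ Icc t T, ∀ x : ℝ, HasDerivAt (fun y => φt s y) (φtx s x) x)
    (hφtxx : ∀ s ∈ Icc t T, ∀ x : ℝ, HasDerivAt (fun y => φtx s y) (φtxx s x) x)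
    (hφts_cont : ContinuousOn (fun p : ℝ × ℝ => φts p.1 p.2) (Icc t T ×ˢ univ))
    (hφtx_cont : ContinuousOn (fun p : ℝ × ℝ => φtx p.1 p.2) (Icc t T ×ˢ univ))
    (hφtxx_cont : ContinuousOn (fun p : ℝ × ℝ => φtxx p.1 p.2) (Icc t T ×ˢ univ))
    (hφt_per : ∀ s x, φt s (x + P) = φt s x)
    -- u(s,·): the unique C¹ P-periodic zero-mean antiderivative of q - mean(q)
    (u : ℝ → ℝ → ℝ)
    (hu_deriv : ∀ s ∈ Icc t T, ∀ x : ℝ,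
      HasDerivAt (fun y => u s y)
        (q s x - (1 / P) * ∫ y in (0:ℝ)..P, q s y) x)
    (hu_per : ∀ s ∈ Icc t T, ∀ x : ℝ, u s (x + P) = u s x)
    (hu_mean : ∀ s ∈ Icc t T, (∫ x in (0:ℝ)..P, u s x) = 0)
    -- w(s,·): the unique C¹ P-periodic zero-mean antiderivative of q∂ₓφ - mean
    (w : ℝ → ℝ → ℝ)
    (hw_deriv : ∀ s ∈ Icc t T, ∀ x : ℝ,
      HasDerivAt (fun y => w s y)
        (q s x * φx s x - (1 / P) * ∫ y in (0:ℝ)..P, q s y * φx s y) x)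
    (hw_per : ∀ s ∈ Icc t T, ∀ x : ℝ, w s (x + P) = w s x)
    (hw_mean : ∀ s ∈ Icc t T, (∫ x in (0:ℝ)..P, w s x) = 0)
    -- boundedness of the spatial derivative of the drift b = u + ∂ₓφ̃
    (hb_bdd : ∃ M : ℝ, ∀ s ∈ Icc t T, ∀ x : ℝ,
      |(q s x - (1 / P) * ∫ y in (0:ℝ)..P, q s y) + φtxx s x| ≤ M)
    -- (i) the coupled MFG-2 system with terminal condition
    (hq_pde : ∀ s ∈ Icc t T, ∀ x : ℝ,
      HasDerivAt (fun y => (u s y + φx s y) * q s y)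
        (D * qxx s x - qs s x) x)
    (hφ_pde : ∀ s ∈ Icc t T, ∀ x : ℝ,
      φs s x + (1 / 2) * (φx s x) ^ 2 + u s x * φx s x - w s x
        + D * φxx s x = F s x)
    (hφ_term : ∀ x, φ T x = -G x)
    -- (ii) the decoupled system with the same initial and terminal data
    (hqt_pde : ∀ s ∈ Icc t T, ∀ x : ℝ,
      HasDerivAt (fun y => (u s y + φtx s y) * qt s y)
        (D * qtxx s x - qts s x) x)
    (hφt_pde : ∀ s ∈ Icc t T, ∀ x : ℝ,
      φts s x + (1 / 2) * (φtx s x) ^ 2 + u s x * φtx s x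
        + D * φtxx s x = F s x + w s x)
    (hqt_init : ∀ x : ℝ, qt t x = q t x)
    (hφt_term : ∀ x, φt T x = -G x)
    -- (iii) uniqueness of classical periodic solutions of the decoupled backward
    -- terminal value problem
    (huniq : ∀ ψ1 ψ1s ψ1x ψ1xx ψ2 ψ2s ψ2x ψ2xx : ℝ → ℝ → ℝ,
      (∀ s ∈ Icc t T, ∀ x : ℝ,
        HasDerivWithinAt (fun τ => ψ1 τ x) (ψ1s s x) (Icc t T) s) →
      (∀ s ∈ Icc t T, ∀ x : ℝ, HasDerivAt (fun y => ψ1 s y) (ψ1x s x) x) →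
      (∀ s ∈ Icc t T, ∀ x : ℝ, HasDerivAt (fun y => ψ1x s y) (ψ1xx s x) x) →
      ContinuousOn (fun p : ℝ × ℝ => ψ1s p.1 p.2) (Icc t T ×ˢ univ) →
      ContinuousOn (fun p : ℝ × ℝ => ψ1x p.1 p.2) (Icc t T ×ˢ univ) →
      ContinuousOn (fun p : ℝ × ℝ => ψ1xx p.1 p.2) (Icc t T ×ˢ univ) →
      (∀ s x, ψ1 s (x + P) = ψ1 s x) →
      (∀ s ∈ Icc t T, ∀ x : ℝ,
        ψ1s s x + (1 / 2) * (ψ1x s x) ^ 2 + u s x * ψ1x s x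
          + D * ψ1xx s x = F s x + w s x) →
      (∀ x, ψ1 T x = -G x) →
      (∀ s ∈ Icc t T, ∀ x : ℝ,
        HasDerivWithinAt (fun τ => ψ2 τ x) (ψ2s s x) (Icc t T) s) →
      (∀ s ∈ Icc t T, ∀ x : ℝ, HasDerivAt (fun y => ψ2 s y) (ψ2x s x) x) →
      (∀ s ∈ Icc t T, ∀ x : ℝ, HasDerivAt (fun y => ψ2x s y) (ψ2xx s x) x) →
      ContinuousOn (fun p : ℝ × ℝ => ψ2s p.1 p.2) (Icc t T ×ˢ univ) →
      ContinuousOn (fun p : ℝ × ℝ => ψ2x p.1 p.2) (Icc t T ×ˢ univ) →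
      ContinuousOn (fun p : ℝ × ℝ => ψ2xx p.1 p.2) (Icc t T ×ˢ univ) →
      (∀ s x, ψ2 s (x + P) = ψ2 s x) →
      (∀ s ∈ Icc t T, ∀ x : ℝ,
        ψ2s s x + (1 / 2) * (ψ2x s x) ^ 2 + u s x * ψ2x s x
          + D * ψ2xx s x = F s x + w s x) →
      (∀ x, ψ2 T x = -G x) →
      ∀ s ∈ Icc t T, ∀ x : ℝ, ψ1 s x = ψ2 s x) :
    (∀ s ∈ Icc t T, ∀ x : ℝ, qt s x = q s x) ∧
    (∀ s ∈ Icc t T, ∀ x : ℝ, φt s x = φ s x) := by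
  have hφ_eq : ∀ s ∈ Icc t T, ∀ x : ℝ, φt s x = φ s x :=
    huniq φt φts φtx φtxx φ φs φx φxx hφts hφtx hφtxx hφts_cont hφtx_cont hφtxx_cont hφt_per
      hφt_pde hφt_term hφs hφx hφxx hφs_cont hφx_cont hφxx_cont hφ_per
      (fun s hs x => by linarith [hφ_pde s hs x]) hφ_term
  refine ⟨?_, hφ_eq⟩
  obtain ⟨M, hM⟩ := hb_bdd
  have hφx_eq : ∀ s ∈ Icc t T, ∀ x : ℝ, φx s x = φtx s x := fun s hs x => by
    have h := hφtx s hs x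
    rw [show (fun y => φt s y) = fun y => φ s y from funext (hφ_eq s hs)] at h
    exact (hφx s hs x).unique h
  -- both vorticities solve the same equation in nondivergence form
  have hpde : ∀ s ∈ Icc t T, ∀ x : ℝ, qts s x - qs s x = D * (qtxx s x - qxx s x)
      - (u s x + φtx s x) * (qtx s x - qx s x)
      - ((q s x - (1 / P) * ∫ y in (0:ℝ)..P, q s y) + φtxx s x) * (qt s x - q s x) := by
    intro s hs x
    have hb := (hu_deriv s hs x).add (hφtxx s hs x)
    have h₁ := (hqt_pde s hs x).unique (hb.mul (hqtx s hs x))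
    have h₂ := hq_pde s hs x
    simp only [hφx_eq s hs] at h₂
    have h₃ := h₂.unique (hb.mul (hqx s hs x))
    simp only [Pi.add_apply] at h₁ h₃
    linarith
  intro s hs x
  refine le_antisymm (sub_nonpos.1 ?_) (sub_nonpos.1 ?_)
  · exact periodic_advection_diffusion_nonpos (r := fun s x => qt s x - q s x) hD.le hP
      (fun s hs x => (hqts s hs x).sub (hqs s hs x))
      (fun s hs x => (hqtx s hs x).sub (hqx s hs x))
      (fun s hs x => (hqtxx s hs x).sub (hqxx s hs x))
      (hqts_cont.sub hqs_cont) (fun s x => by simp only [hqt_per, hq_per]) hM hpde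
      (fun x => by simp [hqt_init]) s hs x
  · exact periodic_advection_diffusion_nonpos (r := fun s x => q s x - qt s x)
      (b := fun s x => u s x + φtx s x) hD.le hP
      (fun s hs x => (hqs s hs x).sub (hqts s hs x))
      (fun s hs x => (hqx s hs x).sub (hqtx s hs x))
      (fun s hs x => (hqxx s hs x).sub (hqtxx s hs x))
      (hqs_cont.sub hqts_cont) (fun s x => by simp only [hqt_per, hq_per]) hM
      (fun s hs x => by linarith [hpde s hs x])
      (fun x => by simp [hqt_init]) s hs x
end
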